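/- For every α ∈ [0,1] there exists a set G_α ⊆ [1,2] with upper Minkowski dimension 0 and Assouad dimension α. -/

import Mathlib

/-- Minimal number of closed intervals of length `δ` needed to cover `E`. -/
noncomputable def covN (E : Set ℝ) (δ : ℝ) : ℕ :=
  sInf {n : ℕ | ∃ c : Fin n → ℝ, E ⊆ ⋃ i, Set.Icc (c i) (c i + δ)}

/-- Upper Minkowski dimension. -/
noncomputable def dimM (E : Set ℝ) : ℝ :=
  sInf {a : ℝ | 0 < a ∧ ∃ C : ℝ, 0 < C ∧ ∀ δ : ℝ, 0 < δ → δ < 1 →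
    (covN E δ : ℝ) ≤ C * δ ^ (-a)}

/-- Assouad dimension. -/
noncomputable def dimA (E : Set ℝ) : ℝ :=
  sInf {a : ℝ | 0 < a ∧ ∃ C : ℝ, 0 < C ∧ ∀ x y δ : ℝ, 0 < δ → δ < y - x →
    (covN (E ∩ Set.Icc x y) δ : ℝ) ≤ C * ((y - x) / δ) ^ a}

/-- A set covered by a finite family of intervals of length `δ` has covering number at most the
size of the family. -/
theorem covN_le_card {ι : Type*} [Fintype ι] {E : Set ℝ} {δ : ℝ} (c : ι → ℝ)
    (h : ∀ t ∈ E, ∃ i, c i ≤ t ∧ t ≤ c i + δ) : covN E δ ≤ Fintype.card ι := by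
  refine Nat.sInf_le ⟨fun i => c ((Fintype.equivFin ι).symm i), fun t ht => ?_⟩
  obtain ⟨i, hi⟩ := h t ht
  exact Set.mem_iUnion.2 ⟨Fintype.equivFin ι i, by simpa using hi⟩

/-- A finite `δ`-separated subset of a bounded set bounds its covering number from below. -/
theorem card_le_covN {E : Set ℝ} {δ x y : ℝ} (hδ : 0 < δ) (hE : E ⊆ Set.Icc x y)
    (T : Finset ℝ) (hT : (T : Set ℝ) ⊆ E)
    (hsep : ∀ s ∈ T, ∀ t ∈ T, s ≠ t → δ < |s - t|) : T.card ≤ covN E δ := by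
  have hne : {n : ℕ | ∃ c : Fin n → ℝ, E ⊆ ⋃ i, Set.Icc (c i) (c i + δ)}.Nonempty := by
    refine ⟨⌊(y - x) / δ⌋₊ + 1, fun i => x + i * δ, fun t ht => ?_⟩
    obtain ⟨hxt, hty⟩ := hE ht
    have hnn : 0 ≤ (t - x) / δ := div_nonneg (by linarith) hδ.le
    have hle : (t - x) / δ ≤ (y - x) / δ := by gcongr
    refine Set.mem_iUnion.2 ⟨⟨⌊(t - x) / δ⌋₊, Nat.lt_succ_of_le (Nat.floor_mono hle)⟩, ?_⟩
    have hlow := Nat.floor_le hnn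
    have hupp := (Nat.lt_floor_add_one ((t - x) / δ)).le
    rw [le_div_iff₀ hδ] at hlow
    rw [div_le_iff₀ hδ] at hupp
    constructor <;> dsimp only <;> linarith
  obtain ⟨c, hc⟩ : ∃ c : Fin (covN E δ) → ℝ, E ⊆ ⋃ i, Set.Icc (c i) (c i + δ) := Nat.sInf_mem hne
  have hmem : ∀ t : T, ∃ i, (t : ℝ) ∈ Set.Icc (c i) (c i + δ) := fun t =>
    Set.mem_iUnion.1 (hc (hT t.2))
  choose f hf using hmem
  have hinj : Function.Injective f := by
    intro s t hst
    by_contra hne'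
    have hd := hsep s s.2 t t.2 (fun h => hne' (Subtype.ext h))
    have hs := hf s
    have ht := hf t
    rw [hst] at hs
    have : |(s : ℝ) - t| ≤ δ := abs_le.2 ⟨by linarith [hs.1, ht.2], by linarith [hs.2, ht.1]⟩
    linarith
  simpa using Fintype.card_le_of_injective f hinj

/-- The number with binary digits `1` exactly at the positions `k + 1`, `k ∈ F`. -/
noncomputable def binVal (F : Finset ℕ) : ℝ := ∑ k ∈ F, (1 / 2 : ℝ) ^ (k + 1)

theorem binVal_nonneg (F : Finset ℕ) : 0 ≤ binVal F :=
  Finset.sum_nonneg fun _ _ => by positivity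

theorem binVal_Ico {p m : ℕ} (h : p ≤ m) :
    binVal (Finset.Ico p m) = (1 / 2 : ℝ) ^ p - (1 / 2) ^ m := by
  induction m, h using Nat.le_induction with
  | base => simp [binVal]
  | succ m hm ih =>
    unfold binVal at ih ⊢
    rw [Finset.sum_Ico_succ_top hm, ih]
    ring

theorem binVal_le {F : Finset ℕ} {p : ℕ} (h : ∀ k ∈ F, p ≤ k) : binVal F ≤ (1 / 2 : ℝ) ^ p := by
  have hsub : F ⊆ Finset.Ico p (p + F.sup id + 1) := by
    intro k hk
    have : k ≤ F.sup id := Finset.le_sup (f := id) hk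
    rw [Finset.mem_Ico]
    exact ⟨h k hk, by omega⟩
  have hle : binVal F ≤ binVal (Finset.Ico p (p + F.sup id + 1)) :=
    Finset.sum_le_sum_of_subset_of_nonneg hsub fun _ _ _ => by positivity
  rw [binVal_Ico (by omega)] at hle
  have : (0 : ℝ) ≤ (1 / 2) ^ (p + F.sup id + 1) := by positivity
  linarith

theorem binVal_eq_natCast_mul {F : Finset ℕ} {q : ℕ} (h : ∀ k ∈ F, k < q) :
    binVal F = ((∑ k ∈ F, 2 ^ (q - 1 - k) : ℕ) : ℝ) * (1 / 2) ^ q := by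
  unfold binVal
  push_cast
  rw [Finset.sum_mul]
  refine Finset.sum_congr rfl fun k hk => ?_
  obtain ⟨d, rfl⟩ : ∃ d, q = k + 1 + d := ⟨q - (k + 1), by have := h k hk; omega⟩
  rw [show k + 1 + d - 1 - k = d by omega, pow_add _ (k + 1) d, mul_left_comm, ← mul_pow]
  norm_num

theorem binVal_separated {F F' : Finset ℕ} {q : ℕ} (h : ∀ k ∈ F, k < q) (h' : ∀ k ∈ F', k < q)
    (hne : F ≠ F') : (1 / 2 : ℝ) ^ q ≤ |binVal F - binVal F'| := by
  have himage : ∀ A : Finset ℕ, (∀ k ∈ A, k < q) →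
      ∑ k ∈ A, 2 ^ (q - 1 - k) = ∑ k ∈ A.image (fun k => q - 1 - k), 2 ^ k ∧
      (A.image (fun k => q - 1 - k)).image (fun k => q - 1 - k) = A := by
    intro A hA
    constructor
    · rw [Finset.sum_image]
      intro i hi j hj hij
      have := hA i hi
      have := hA j hj
      dsimp only at hij
      omega
    · rw [Finset.image_image]
      conv_rhs => rw [← Finset.image_id (s := A)]
      refine Finset.image_congr fun k hk => ?_
      have := hA k hk
      simp only [Function.comp_apply, id_eq]
      omega
  have hN : ∑ k ∈ F, 2 ^ (q - 1 - k) ≠ ∑ k ∈ F', 2 ^ (q - 1 - k) := by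
    rw [(himage F h).1, (himage F' h').1]
    intro heq
    have := Finset.geomSum_injective le_rfl heq
    apply hne
    rw [← (himage F h).2, ← (himage F' h').2, this]
  rw [binVal_eq_natCast_mul h, binVal_eq_natCast_mul h', ← sub_mul, abs_mul,
    abs_of_nonneg (by positivity : (0 : ℝ) ≤ (1 / 2) ^ q)]
  refine le_mul_of_one_le_left (by positivity) ?_
  have : (1 : ℤ) ≤ |((∑ k ∈ F, 2 ^ (q - 1 - k) : ℕ) : ℤ) - (∑ k ∈ F', 2 ^ (q - 1 - k) : ℕ)| :=
    Int.one_le_abs (sub_ne_zero.2 (by exact_mod_cast hN))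
  exact_mod_cast this

/-- The numbers in `[1, 2]` with finitely many binary digits `1`, all at positions from `S`. -/
def digitSet (S : Set ℕ) : Set ℝ := {t | ∃ F : Finset ℕ, (F : Set ℕ) ⊆ S ∧ t = 1 + binVal F}

theorem digitSet_subset (S : Set ℕ) : digitSet S ⊆ Set.Icc 1 2 := by
  rintro t ⟨F, -, rfl⟩
  have h := binVal_le (F := F) (p := 0) (by simp)
  have := binVal_nonneg F
  constructor <;> linarith

open scoped Classical in
/-- The elements of `S` in `[p, q)`. -/
noncomputable def window (S : Set ℕ) (p q : ℕ) : Finset ℕ := (Finset.Ico p q).filter (· ∈ S)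

theorem mem_window {S : Set ℕ} {p q k : ℕ} : k ∈ window S p q ↔ (p ≤ k ∧ k < q) ∧ k ∈ S := by
  simp [window]

theorem covN_le_of_subset_digitSet {S : Set ℕ} {A : Set ℝ} {p q : ℕ} {x δ : ℝ}
    (hA : A ⊆ digitSet S) (hx : A ⊆ Set.Icc x (x + (1 / 2) ^ p))
    (hδ : (1 / 2 : ℝ) ^ q ≤ δ) : covN A δ ≤ 3 * 2 ^ (window S p q).card := by
  set i₀ : ℤ := ⌈(x - 1) * 2 ^ p⌉ - 1 with hi₀
  have hcov := covN_le_card (ι := Fin 3 × (window S p q).powerset) (E := A) (δ := δ)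
    (fun z => 1 + ((i₀ + (z.1 : ℕ) : ℤ) : ℝ) * (1 / 2) ^ p + binVal z.2) ?_
  · simpa using hcov
  intro t ht
  obtain ⟨F, hFS, rfl⟩ := hA ht
  have hxt := hx ht
  have hsplit : binVal F = binVal (F.filter (· < p)) +
      (binVal ((F.filter (¬ · < p)).filter (· < q)) +
        binVal ((F.filter (¬ · < p)).filter (¬ · < q))) := by
    unfold binVal
    rw [Finset.sum_filter_add_sum_filter_not, Finset.sum_filter_add_sum_filter_not]
  have htail : binVal ((F.filter (¬ · < p)).filter (¬ · < q)) ≤ (1 / 2 : ℝ) ^ q :=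
    binVal_le fun k hk => by simp at hk; omega
  have hrest : binVal ((F.filter (¬ · < p)).filter (· < q)) +
        binVal ((F.filter (¬ · < p)).filter (¬ · < q)) ≤ (1 / 2 : ℝ) ^ p := by
    unfold binVal
    rw [Finset.sum_filter_add_sum_filter_not]
    exact binVal_le fun k hk => by simp at hk; omega
  have htail0 := binVal_nonneg ((F.filter (¬ · < p)).filter (¬ · < q))
  have hmid0 := binVal_nonneg ((F.filter (¬ · < p)).filter (· < q))
  have hpre := binVal_eq_natCast_mul (F := F.filter (· < p)) (q := p) (by simp)
  set N : ℕ := ∑ k ∈ F.filter (· < p), 2 ^ (p - 1 - k)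
  have hpos : (0 : ℝ) < 2 ^ p := by positivity
  have hinv : (1 / 2 : ℝ) ^ p * 2 ^ p = 1 := by rw [← mul_pow]; norm_num
  have hscale : ∀ a b : ℝ, a ≤ b * (1 / 2 : ℝ) ^ p → a * 2 ^ p ≤ b := fun a b hab => by
    calc a * 2 ^ p ≤ b * (1 / 2) ^ p * 2 ^ p := by gcongr
      _ = b := by rw [mul_assoc, hinv, mul_one]
  have hlow : (x - 1) * 2 ^ p ≤ (N : ℝ) + 1 := hscale _ _ (by linarith [hxt.1])
  have hupp : (N : ℝ) ≤ (x - 1) * 2 ^ p + 1 := by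
    have : ((1 - x : ℝ)) * 2 ^ p ≤ 1 - N := hscale _ _ (by linarith [hxt.2])
    linarith
  have hlow' : i₀ ≤ N := by
    have : ⌈(x - 1) * 2 ^ p⌉ ≤ (N : ℤ) + 1 := Int.ceil_le.2 (by push_cast; exact hlow)
    omega
  have hupp' : (N : ℤ) ≤ i₀ + 2 := by
    have : (N : ℝ) ≤ (⌈(x - 1) * 2 ^ p⌉ + 1 : ℤ) := by
      push_cast
      linarith [Int.le_ceil ((x - 1) * 2 ^ p)]
    have : (N : ℤ) ≤ ⌈(x - 1) * 2 ^ p⌉ + 1 := by exact_mod_cast this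
    omega
  have hmem : (F.filter (¬ · < p)).filter (· < q) ∈ (window S p q).powerset := by
    rw [Finset.mem_powerset]
    intro k hk
    simp only [Finset.mem_filter] at hk
    exact mem_window.2 ⟨⟨by omega, hk.2⟩, hFS hk.1.1⟩
  refine ⟨(⟨(N - i₀).toNat, by omega⟩, ⟨_, hmem⟩), ?_⟩
  have hN : (i₀ + ((N - i₀).toNat : ℕ) : ℤ) = N := by omega
  dsimp only
  rw [hN, Int.cast_natCast]
  constructor <;> linarith

theorem two_pow_card_le_covN (S : Set ℕ) (p q : ℕ) {δ : ℝ} (hδ : 0 < δ)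
    (hδq : δ < (1 / 2 : ℝ) ^ q) :
    2 ^ (window S p q).card ≤ covN (digitSet S ∩ Set.Icc 1 (1 + (1 / 2) ^ p)) δ := by
  have hlt : ∀ F ∈ (window S p q).powerset, ∀ k ∈ F, k < q := fun F hF k hk =>
    (mem_window.1 (Finset.mem_powerset.1 hF hk)).1.2
  have hinj : Set.InjOn (fun F => 1 + binVal F) ((window S p q).powerset : Set (Finset ℕ)) := by
    intro F hF F' hF' heq
    by_contra hne
    have hs := binVal_separated (hlt F hF) (hlt F' hF') hne
    have : binVal F = binVal F' := by simpa using heq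
    rw [this, sub_self, abs_zero] at hs
    linarith
  rw [← Finset.card_powerset, ← Finset.card_image_of_injOn hinj]
  refine card_le_covN hδ Set.inter_subset_right _ ?_ ?_
  · intro t ht
    obtain ⟨F, hF, rfl⟩ := Finset.mem_image.1 (Finset.mem_coe.1 ht)
    have hsub := Finset.mem_powerset.1 hF
    have hle := binVal_le (F := F) (p := p) fun k hk => (mem_window.1 (hsub hk)).1.1
    have := binVal_nonneg F
    exact ⟨⟨F, fun k hk => (mem_window.1 (hsub hk)).2, rfl⟩, by linarith,
      by linarith⟩
  · intro s hs t ht hst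
    obtain ⟨F, hF, rfl⟩ := Finset.mem_image.1 hs
    obtain ⟨F', hF', rfl⟩ := Finset.mem_image.1 ht
    have := binVal_separated (hlt F hF) (hlt F' hF') fun h => hst (by rw [h])
    rw [add_sub_add_left_eq_sub]
    linarith

/-- If `S` has upper density zero, then `digitSet S` has upper Minkowski dimension zero. -/
theorem dimM_digitSet_eq_zero {S : Set ℕ}
    (hS : ∀ a : ℝ, 0 < a → ∃ K : ℝ, ∀ q, ((window S 0 q).card : ℝ) ≤ a * q + K) :
    dimM (digitSet S) = 0 := by
  suffices h : {a : ℝ | 0 < a ∧ ∃ C : ℝ, 0 < C ∧ ∀ δ : ℝ, 0 < δ → δ < 1 →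
      (covN (digitSet S) δ : ℝ) ≤ C * δ ^ (-a)} = Set.Ioi 0 by
    rw [dimM, h, csInf_Ioi]
  refine Set.Subset.antisymm (fun a ha => ha.1) fun a (ha : 0 < a) => ⟨ha, ?_⟩
  obtain ⟨K, hK⟩ := hS a ha
  refine ⟨3 * 2 ^ (a + K), by positivity, fun δ hδ hδ1 => ?_⟩
  set u : ℝ := -Real.logb 2 δ with hu
  have hδu : δ = 2 ^ (-u) := by
    rw [hu, neg_neg, Real.rpow_logb (by norm_num) (by norm_num) hδ]
  have hu0 : 0 ≤ u := by
    have := Real.logb_nonpos (by norm_num : (1 : ℝ) < 2) hδ.le hδ1.le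
    linarith
  have hcov := covN_le_of_subset_digitSet (S := S) (A := digitSet S) (p := 0) (q := ⌈u⌉₊) (x := 1)
    (δ := δ) subset_rfl (by norm_num; exact digitSet_subset S) (by
      rw [hδu, one_div, inv_pow, ← Real.rpow_natCast, ← Real.rpow_neg (by norm_num)]
      exact Real.rpow_le_rpow_of_exponent_le (by norm_num) (neg_le_neg (Nat.le_ceil u)))
  calc (covN (digitSet S) δ : ℝ) ≤ 3 * 2 ^ (window S 0 ⌈u⌉₊).card := by exact_mod_cast hcov
    _ ≤ 3 * (2 ^ (a + K) * 2 ^ (a * u)) := by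
        rw [← Real.rpow_natCast, ← Real.rpow_add (by norm_num)]
        gcongr
        · norm_num
        · have := hK ⌈u⌉₊
          have := mul_le_mul_of_nonneg_left (Nat.ceil_lt_add_one hu0).le ha.le
          linarith
    _ = 3 * 2 ^ (a + K) * δ ^ (-a) := by
        rw [hδu, ← Real.rpow_mul (by norm_num)]
        ring_nf

/-- If `S` has upper Banach density `α`, witnessed by additive errors, then `digitSet S` has
Assouad dimension `α`. -/
theorem dimA_digitSet_eq {S : Set ℕ} {α : ℝ} (h0 : 0 ≤ α)
    (hupp : ∀ p q : ℕ, p ≤ q → ((window S p q).card : ℝ) ≤ α * (q - p) + 1)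
    (hlow : ∀ n : ℕ, ∃ p : ℕ, α * n - 1 ≤ ((window S p (p + n)).card : ℝ)) :
    dimA (digitSet S) = α := by
  have hmem : ∀ a : ℝ, α < a → a ∈ {a : ℝ | 0 < a ∧ ∃ C : ℝ, 0 < C ∧ ∀ x y δ : ℝ, 0 < δ →
      δ < y - x → (covN (digitSet S ∩ Set.Icc x y) δ : ℝ) ≤ C * ((y - x) / δ) ^ a} := by
    intro a ha
    have ha0 : 0 < a := h0.trans_lt ha
    refine ⟨ha0, 3 * 2 ^ (2 * a + 1), by positivity, fun x y δ hδ hxy => ?_⟩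
    have hL : 0 < y - x := hδ.trans hxy
    set u : ℝ := -Real.logb 2 δ with hu
    set v : ℝ := -Real.logb 2 (y - x) with hv
    have hδu : δ = 2 ^ (-u) := by
      rw [hu, neg_neg, Real.rpow_logb (by norm_num) (by norm_num) hδ]
    have hLv : y - x = 2 ^ (-v) := by
      rw [hv, neg_neg, Real.rpow_logb (by norm_num) (by norm_num) hL]
    have hvu : v ≤ u :=
      neg_le_neg (Real.logb_le_logb_of_le (by norm_num) hδ hxy.le)
    have hpq : ⌊v⌋₊ ≤ ⌈u⌉₊ := (Nat.floor_le_ceil v).trans (Nat.ceil_mono hvu)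
    have hδq : (1 / 2 : ℝ) ^ ⌈u⌉₊ ≤ δ := by
      rw [hδu, one_div, inv_pow, ← Real.rpow_natCast, ← Real.rpow_neg (by norm_num)]
      exact Real.rpow_le_rpow_of_exponent_le (by norm_num) (neg_le_neg (Nat.le_ceil u))
    have hcov : covN (digitSet S ∩ Set.Icc x y) δ ≤ 3 * 2 ^ (window S ⌊v⌋₊ ⌈u⌉₊).card := by
      rcases le_or_gt 0 v with hv0 | hv0
      · refine covN_le_of_subset_digitSet (x := x) Set.inter_subset_left
          (Set.inter_subset_right.trans (Set.Icc_subset_Icc_right ?_)) hδq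
        have : y - x ≤ (1 / 2 : ℝ) ^ ⌊v⌋₊ := by
          rw [hLv, one_div, inv_pow, ← Real.rpow_natCast, ← Real.rpow_neg (by norm_num)]
          exact Real.rpow_le_rpow_of_exponent_le (by norm_num) (neg_le_neg (Nat.floor_le hv0))
        linarith
      · refine covN_le_of_subset_digitSet (x := 1) Set.inter_subset_left
          (Set.inter_subset_left.trans ((digitSet_subset S).trans ?_)) hδq
        rw [Nat.floor_of_nonpos hv0.le]
        norm_num
    have hlen : (⌈u⌉₊ : ℝ) - ⌊v⌋₊ ≤ u - v + 2 := by
      have hv1 := Nat.lt_floor_add_one v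
      rcases le_or_gt 0 u with hu0 | hu0
      · have := Nat.ceil_lt_add_one hu0
        linarith
      · rw [Nat.ceil_eq_zero.2 hu0.le, Nat.floor_of_nonpos (hvu.trans hu0.le)]
        norm_num
        linarith
    have hlen0 : (0 : ℝ) ≤ (⌈u⌉₊ : ℝ) - ⌊v⌋₊ := sub_nonneg.2 (by exact_mod_cast hpq)
    calc (covN (digitSet S ∩ Set.Icc x y) δ : ℝ)
        ≤ 3 * 2 ^ (window S ⌊v⌋₊ ⌈u⌉₊).card := by exact_mod_cast hcov
      _ ≤ 3 * (2 ^ (2 * a + 1) * 2 ^ ((u - v) * a)) := by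
          rw [← Real.rpow_natCast, ← Real.rpow_add (by norm_num)]
          gcongr
          · norm_num
          · have h1 := hupp _ _ hpq
            have h2 := mul_le_mul_of_nonneg_right ha.le hlen0
            have h3 := mul_le_mul_of_nonneg_left hlen ha0.le
            linarith
      _ = 3 * 2 ^ (2 * a + 1) * ((y - x) / δ) ^ a := by
          rw [hLv, hδu, ← Real.rpow_sub (by norm_num), ← Real.rpow_mul (by norm_num)]
          ring_nf
  refine csInf_eq_of_forall_ge_of_forall_gt_exists_lt ⟨α + 1, hmem _ (by linarith)⟩ ?_ ?_
  · rintro a ⟨ha0, C, hC, hbound⟩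
    by_contra! haα
    have hgrow : ∀ n : ℕ, ((α - a) * n - 1 - a) ≤ Real.logb 2 C := by
      intro n
      obtain ⟨p, hp⟩ := hlow n
      have hpow : (1 / 2 : ℝ) ^ (p + n + 1) < (1 / 2) ^ (p + n) :=
        pow_lt_pow_right_of_lt_one₀ (by norm_num) (by norm_num) (by omega)
      have hc := two_pow_card_le_covN S p (p + n) (δ := (1 / 2) ^ (p + n + 1)) (by positivity) hpow
      have hb := hbound 1 (1 + (1 / 2) ^ p) ((1 / 2) ^ (p + n + 1)) (by positivity) (by
        rw [add_sub_cancel_left]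
        exact pow_lt_pow_right_of_lt_one₀ (by norm_num) (by norm_num) (by omega))
      have hratio : (1 + (1 / 2 : ℝ) ^ p - 1) / (1 / 2) ^ (p + n + 1) = 2 ^ ((n : ℝ) + 1) := by
        rw [add_sub_cancel_left, show p + n + 1 = p + (n + 1) by ring, pow_add _ p,
          div_mul_cancel_left₀ (by positivity), one_div, inv_pow, inv_inv, ← Real.rpow_natCast]
        push_cast
        rfl
      rw [hratio, ← Real.rpow_mul (by norm_num)] at hb
      have hc' : (2 : ℝ) ^ (α * n - 1) ≤ 2 ^ Real.logb 2 C * 2 ^ (((n : ℝ) + 1) * a) := by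
        rw [Real.rpow_logb (by norm_num) (by norm_num) hC]
        refine le_trans ?_ hb
        refine (Real.rpow_le_rpow_of_exponent_le (by norm_num) hp).trans ?_
        rw [Real.rpow_natCast]
        exact_mod_cast hc
      rw [← Real.rpow_add (by norm_num), Real.rpow_le_rpow_left_iff (by norm_num)] at hc'
      linarith
    obtain ⟨n, hn⟩ := exists_nat_gt ((Real.logb 2 C + 1 + a) / (α - a))
    rw [div_lt_iff₀ (sub_pos.2 haα)] at hn
    linarith [hgrow n]
  · intro w hw
    exact ⟨(α + w) / 2, hmem _ (by linarith), by linarith⟩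

/-- The positions where the Beatty sequence `⌊k α⌋` jumps. -/
def beattyJumps (α : ℝ) : Set ℕ := {k | ⌊(k : ℝ) * α⌋₊ < ⌊((k + 1 : ℕ) : ℝ) * α⌋₊}

theorem card_window_beattyJumps {α : ℝ} (h0 : 0 ≤ α) (h1 : α ≤ 1) {p q : ℕ} (hpq : p ≤ q) :
    (window (beattyJumps α) p q).card + ⌊(p : ℝ) * α⌋₊ = ⌊(q : ℝ) * α⌋₊ := by
  classical
  induction q, hpq using Nat.le_induction with
  | base => simp [window]
  | succ q hq ih =>
    have hmono : ⌊(q : ℝ) * α⌋₊ ≤ ⌊((q + 1 : ℕ) : ℝ) * α⌋₊ := by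
      gcongr
      omega
    have hstep : ⌊((q + 1 : ℕ) : ℝ) * α⌋₊ ≤ ⌊(q : ℝ) * α⌋₊ + 1 := by
      rw [← Nat.floor_add_one (by positivity)]
      apply Nat.floor_mono
      push_cast
      linarith
    have hcard : (window (beattyJumps α) p (q + 1)).card =
        (window (beattyJumps α) p q).card + if q ∈ beattyJumps α then 1 else 0 := by
      simp only [window, Finset.card_filter, Finset.sum_Ico_succ_top hq]
    rw [hcard]
    by_cases hj : q ∈ beattyJumps α
    · rw [if_pos hj]
      have : ⌊(q : ℝ) * α⌋₊ < ⌊((q + 1 : ℕ) : ℝ) * α⌋₊ := hj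
      omega
    · rw [if_neg hj]
      have : ¬ ⌊(q : ℝ) * α⌋₊ < ⌊((q + 1 : ℕ) : ℝ) * α⌋₊ := hj
      omega

/-- A set of density zero that contains arbitrarily long intervals. -/
def sparseBlocks : Set ℕ := {k | ∃ n j : ℕ, j < n ∧ k = n ^ 4 + j}

theorem card_window_sparseBlocks {a : ℝ} (ha : 0 < a) (q : ℕ) :
    ((window sparseBlocks 0 q).card : ℝ) ≤ a * q + (2 + 1 / a) := by
  set r := Nat.sqrt q
  set s := Nat.sqrt r
  have hsub : window sparseBlocks 0 q ⊆
      (Finset.range (s + 1) ×ˢ Finset.range (s + 1)).image (fun z => z.1 ^ 4 + z.2) := by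
    intro k hk
    obtain ⟨⟨-, hkq⟩, n, j, hj, rfl⟩ := mem_window.1 hk
    have hn : n ≤ s := by
      rw [Nat.le_sqrt, Nat.le_sqrt]
      have : n * n * (n * n) = n ^ 4 := by ring
      omega
    exact Finset.mem_image.2 ⟨(n, j), by simp; omega, rfl⟩
  have hcard := (Finset.card_le_card hsub).trans Finset.card_image_le
  rw [Finset.card_product, Finset.card_range] at hcard
  have hs : (s : ℝ) * s ≤ r := by exact_mod_cast Nat.sqrt_le r
  have hr : (r : ℝ) * r ≤ q := by exact_mod_cast Nat.sqrt_le q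
  have hcard' : ((window sparseBlocks 0 q).card : ℝ) ≤ (s + 1) * (s + 1) := by exact_mod_cast hcard
  have hamgm : 2 * (r : ℝ) ≤ a * (r * r) + 1 / a := by
    have : a * (r * r) + 1 / a - 2 * (r : ℝ) = (a * r - 1) ^ 2 / a := by
      field_simp
      ring
    have : 0 ≤ (a * r - 1) ^ 2 / a := by positivity
    linarith
  have := mul_le_mul_of_nonneg_left hr ha.le
  nlinarith [sq_nonneg ((s : ℝ) - 1)]

theorem window_mono {S T : Set ℕ} (h : S ⊆ T) (p q : ℕ) : window S p q ⊆ window T p q :=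
  fun _ hk => mem_window.2 ⟨(mem_window.1 hk).1, h (mem_window.1 hk).2⟩

/-- For every `α ∈ [0,1]` there is a set `G ⊆ [1,2]` with upper Minkowski dimension `0`
and Assouad dimension `α`. -/
theorem stmt7 (α : ℝ) (h0 : 0 ≤ α) (h1 : α ≤ 1) :
    ∃ G : Set ℝ, G ⊆ Set.Icc 1 2 ∧ dimM G = 0 ∧ dimA G = α := by
  refine ⟨digitSet (beattyJumps α ∩ sparseBlocks), digitSet_subset _,
    dimM_digitSet_eq_zero fun a ha => ⟨2 + 1 / a, fun q => ?_⟩,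
    dimA_digitSet_eq h0 (fun p q hpq => ?_) fun n => ⟨n ^ 4, ?_⟩⟩
  · refine le_trans ?_ (card_window_sparseBlocks ha q)
    exact_mod_cast Finset.card_le_card (window_mono Set.inter_subset_right 0 q)
  · have hle : ((window (beattyJumps α ∩ sparseBlocks) p q).card : ℝ) ≤
        (window (beattyJumps α) p q).card := by
      exact_mod_cast Finset.card_le_card (window_mono Set.inter_subset_left p q)
    have heq : ((window (beattyJumps α) p q).card : ℝ) + ⌊(p : ℝ) * α⌋₊ = ⌊(q : ℝ) * α⌋₊ := by
      exact_mod_cast card_window_beattyJumps h0 h1 hpq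
    have := Nat.floor_le (by positivity : 0 ≤ (q : ℝ) * α)
    have := Nat.lt_floor_add_one ((p : ℝ) * α)
    linarith
  · have hwin : window (beattyJumps α ∩ sparseBlocks) (n ^ 4) (n ^ 4 + n) =
        window (beattyJumps α) (n ^ 4) (n ^ 4 + n) := by
      refine (window_mono Set.inter_subset_left _ _).antisymm fun k hk => ?_
      obtain ⟨hk, hkα⟩ := mem_window.1 hk
      exact mem_window.2 ⟨hk, hkα, n, k - n ^ 4, by omega, by omega⟩
    have heq : ((window (beattyJumps α) (n ^ 4) (n ^ 4 + n)).card : ℝ) +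
        ⌊((n ^ 4 : ℕ) : ℝ) * α⌋₊ = ⌊((n ^ 4 + n : ℕ) : ℝ) * α⌋₊ := by
      exact_mod_cast card_window_beattyJumps h0 h1 (Nat.le_add_right (n ^ 4) n)
    have := Nat.floor_le (by positivity : 0 ≤ ((n ^ 4 : ℕ) : ℝ) * α)
    have := Nat.lt_floor_add_one (((n ^ 4 + n : ℕ) : ℝ) * α)
    rw [hwin]
    push_cast at *
    linarith
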